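/- arXiv:1510.06425 — 11 statements merged into one kernel-verified Lean document; each statement's English description precedes it below -/
import Mathlib

section
/- Let m ≥ 2, r ≥ 2 and λ ≥ 1 be integers with gcd(m, r·λ) = 1. Let s ≥ 1 be an integer and let t be the unique integer with 0 ≤ t ≤ m − 1 and m ∣ (s + λ·t). Then r·((t·λ) mod m) > m·(1 + ⌊(s−1)/m⌋) if and only if s ∈ Λ(m,r). -/
/-- The set Λ(m,r) = {1 + i + m·j : 0 ≤ i ≤ m − 2 − ⌊m/r⌋, 0 ≤ j ≤ r − 2 − ⌊r(i+1)/m⌋},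
with the bounds written additively (i + ⌊m/r⌋ + 2 ≤ m, etc.) to match the integer
inequalities exactly. -/
def Lambda (m r : ℕ) : Set ℕ :=
  {s | ∃ i j : ℕ, i + m / r + 2 ≤ m ∧ j + (r * (i + 1)) / m + 2 ≤ r ∧ s = 1 + i + m * j}

/-- If `m` divides `1 + i + m * j + n` with `i < m`, then the remainder of `n` modulo `m` is
determined by `i`. -/
theorem mod_add_succ_eq_of_dvd {m n i : ℕ} (j : ℕ) (hi : i < m) (h : m ∣ 1 + i + m * j + n) :
    n % m + (i + 1) = m := by
  have hlt : n % m < m := Nat.mod_lt _ (by omega)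
  have hd : m ∣ n % m + (i + 1) := by
    have h2 : m ∣ (n % m + (i + 1)) + m * (j + n / m) := by
      convert h using 1
      linarith [Nat.mod_add_div n m, mul_add m j (n / m)]
    exact (Nat.dvd_add_left (dvd_mul_right _ _)).mp h2
  obtain ⟨c, hc⟩ := hd
  obtain rfl : c = 1 := by
    have : 0 < c := Nat.pos_of_ne_zero (by rintro rfl; omega)
    have : c < 2 := by
      by_contra! hc2
      nlinarith
    omega
  omega

/-- The strict inequality for the complementary residue `v` in terms of the quotient bound. -/
theorem lt_mul_iff_add_div_add_two_le {m r v a : ℕ} (j : ℕ) (hm : 0 < m) (h : v + a = m) :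
    m * (1 + j) < r * v ↔ j + r * a / m + 2 ≤ r := by
  have hsum : r * v + r * a = m * r := by rw [← mul_add, h, mul_comm]
  have hdiv : r * a / m < r - (1 + j) ↔ r * a < (r - (1 + j)) * m := Nat.div_lt_iff_lt_mul hm
  generalize r * a / m = q at hdiv ⊢
  rcases le_total (1 + j) r with hj | hj
  · obtain ⟨k, rfl⟩ := Nat.exists_eq_add_of_le hj
    simp only [Nat.add_sub_cancel_left] at hdiv
    have : m * (1 + j + k) = m * (1 + j) + k * m := by ring
    omega
  · have := Nat.mul_le_mul_left m hj
    omega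

/-- Abdón–Borges–Quoos gap criterion: for a Kummer extension $y^m = f(x)^λ$ with
$\gcd(m, rλ) = 1$, a positive integer $s$ is a gap at a totally ramified place
$P ≠ P_∞$ (i.e. $s ∈ Λ(m,r)$) iff $r\{tλ/m\} > 1 + ⌊(s-1)/m⌋$, where $t$ is the
unique integer in $[0, m-1]$ with $m ∣ s + λt$.  (Both sides multiplied by $m$.) -/
theorem stmt_0 (m r l s t : ℕ) (hm : 2 ≤ m) (hr : 2 ≤ r) (hl : 1 ≤ l)
    (hgcd : Nat.gcd m (r * l) = 1) (hs : 1 ≤ s)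
    (ht : t ≤ m - 1) (hdvd : m ∣ s + l * t) :
    r * ((t * l) % m) > m * (1 + (s - 1) / m) ↔ s ∈ Lambda m r := by
  have hm0 : 0 < m := by omega
  rw [mul_comm l t] at hdvd
  rw [gt_iff_lt]
  constructor
  · intro h
    have hi : (s - 1) % m < m := Nat.mod_lt _ hm0
    have hs' : s = 1 + (s - 1) % m + m * ((s - 1) / m) := by
      have := Nat.mod_add_div (s - 1) m
      omega
    have hv := mod_add_succ_eq_of_dvd _ hi (hs' ▸ hdvd)
    refine ⟨(s - 1) % m, (s - 1) / m, ?_, (lt_mul_iff_add_div_add_two_le _ hm0 hv).mp h, hs'⟩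
    have hlt : m / r < t * l % m := by
      rw [Nat.div_lt_iff_lt_mul (by omega), mul_comm]
      exact lt_of_le_of_lt (Nat.le_mul_of_pos_right m (Nat.add_pos_left one_pos _)) h
    omega
  · rintro ⟨i, j, hi, hj, rfl⟩
    have him : i < m := by
      generalize m / r = q at hi
      omega
    have hq : (1 + i + m * j - 1) / m = j := by
      rw [add_assoc, Nat.add_sub_cancel_left, Nat.add_mul_div_left _ _ hm0,
        Nat.div_eq_of_lt him, zero_add]
    rw [hq]
    exact (lt_mul_iff_add_div_add_two_le j hm0 (mod_add_succ_eq_of_dvd j him hdvd)).mpr hj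
end

section
/- Let m ≥ 2 and r ≥ 2 be integers with gcd(m, r) = 1. Then the cardinality of Λ(m,r) is (m−1)(r−1)/2. -/
/-- The interior lattice points of the rectangle `[0, m] × [0, r]` lying strictly below the diagonal
from `(0, r)` to `(m, 0)`. -/
def pointsBelowDiagonal (m r : ℕ) : Finset (ℕ × ℕ) :=
  (Finset.Ioo 0 m ×ˢ Finset.Ioo 0 r).filter fun p => p.2 * m + r * p.1 < r * m

theorem mem_pointsBelowDiagonal {m r : ℕ} {p : ℕ × ℕ} :
    p ∈ pointsBelowDiagonal m r ↔
      ((0 < p.1 ∧ p.1 < m) ∧ 0 < p.2 ∧ p.2 < r) ∧ p.2 * m + r * p.1 < r * m := by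
  simp [pointsBelowDiagonal]

theorem Nat.Coprime.diagonal_ne {m r a b : ℕ} (h : Nat.Coprime m r) (ha : 0 < a) (ham : a < m) :
    b * m + r * a ≠ r * m := by
  intro e
  have h1 : m ∣ r * a :=
    (Nat.dvd_add_right (Dvd.intro_left b rfl)).1 (e ▸ Dvd.intro_left r rfl)
  exact absurd (Nat.le_of_dvd ha (h.dvd_of_dvd_mul_left h1)) (by omega)

theorem two_mul_card_pointsBelowDiagonal {m r : ℕ} (h : Nat.Coprime m r) :
    2 * (pointsBelowDiagonal m r).card = (m - 1) * (r - 1) := by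
  have hsplit := Finset.card_filter_add_card_filter_not (s := Finset.Ioo 0 m ×ˢ Finset.Ioo 0 r)
    (fun p => p.2 * m + r * p.1 < r * m)
  have hrefl : (pointsBelowDiagonal m r).card =
      ((Finset.Ioo 0 m ×ˢ Finset.Ioo 0 r).filter
        fun p => ¬ p.2 * m + r * p.1 < r * m).card := by
    refine Finset.card_bij' (fun p _ => (m - p.1, r - p.2)) (fun p _ => (m - p.1, r - p.2))
      ?_ ?_ ?_ ?_
    · rintro ⟨a, b⟩ hp
      obtain ⟨⟨⟨h1, h2⟩, h3, h4⟩, h5⟩ := mem_pointsBelowDiagonal.1 hp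
      simp only [Finset.mem_filter, Finset.mem_product, Finset.mem_Ioo] at *
      refine ⟨by omega, ?_⟩
      zify [h2.le, h4.le] at h5 ⊢
      linarith
    · rintro ⟨a, b⟩ hp
      simp only [Finset.mem_filter, Finset.mem_product, Finset.mem_Ioo] at hp
      obtain ⟨⟨⟨h1, h2⟩, h3, h4⟩, h5⟩ := hp
      have h6 := lt_of_le_of_ne (not_lt.1 h5) (h.diagonal_ne h1 h2).symm
      refine mem_pointsBelowDiagonal.2 ⟨by dsimp only; omega, ?_⟩
      zify [h2.le, h4.le] at h6 ⊢
      linarith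
    · rintro ⟨a, b⟩ hp
      have := mem_pointsBelowDiagonal.1 hp
      ext <;> dsimp only at * <;> omega
    · rintro ⟨a, b⟩ hp
      simp only [Finset.mem_filter, Finset.mem_product, Finset.mem_Ioo] at hp
      ext <;> dsimp only at * <;> omega
  rw [← hrefl, Finset.card_product, Nat.card_Ioo, Nat.card_Ioo] at hsplit
  change (pointsBelowDiagonal m r).card + _ = _ at hsplit
  simp only [Nat.sub_zero] at hsplit
  omega

theorem Lambda_eq_image {m r : ℕ} (hm : 0 < m) (hr : 0 < r) :
    Lambda m r = (fun p : ℕ × ℕ => p.1 + m * (p.2 - 1)) '' (pointsBelowDiagonal m r) := by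
  ext s
  simp only [Lambda, Set.mem_ofPred_eq, Set.mem_image, Finset.mem_coe, mem_pointsBelowDiagonal,
    Prod.exists]
  constructor
  · rintro ⟨i, j, hi, hj, rfl⟩
    have him : i + 2 ≤ m := by linarith [Nat.zero_le (m / r)]
    have hjr : j + 2 ≤ r := by linarith [Nat.zero_le (r * (i + 1) / m)]
    refine ⟨i + 1, j + 1, ⟨by omega, ?_⟩, by simp [add_comm]⟩
    have h1 : r * (i + 1) / m < r - 1 - j := by omega
    rw [Nat.div_lt_iff_lt_mul hm] at h1
    have h2 : j + 1 ≤ r := by omega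
    rw [Nat.sub_sub, add_comm 1 j] at h1
    zify [h2] at h1 ⊢
    linarith
  · rintro ⟨a, b, ⟨⟨⟨ha, ham⟩, hb, hbr⟩, hab⟩, rfl⟩
    obtain ⟨i, rfl⟩ := Nat.exists_eq_add_of_lt ha
    obtain ⟨j, rfl⟩ := Nat.exists_eq_add_of_lt hb
    simp only [zero_add] at *
    refine ⟨i, j, ?_, ?_, by simp [add_comm]⟩
    · have h1 : m / r < m - (i + 1) := by
        rw [Nat.div_lt_iff_lt_mul hr]
        zify [ham.le] at hab ⊢
        nlinarith
      omega
    · have h1 : r * (i + 1) / m < r - (j + 1) := by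
        rw [Nat.div_lt_iff_lt_mul hm]
        zify [hbr.le] at hab ⊢
        linarith
      omega

theorem injOn_pointsBelowDiagonal (m r : ℕ) :
    Set.InjOn (fun p : ℕ × ℕ => p.1 + m * (p.2 - 1)) (pointsBelowDiagonal m r) := by
  rintro ⟨a, b⟩ hp ⟨c, d⟩ hq h
  obtain ⟨⟨⟨-, ha⟩, hb, -⟩, -⟩ := mem_pointsBelowDiagonal.1 hp
  obtain ⟨⟨⟨-, hc⟩, hd, -⟩, -⟩ := mem_pointsBelowDiagonal.1 hq
  dsimp only at *
  have hac : a = c := by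
    simpa [Nat.add_mul_mod_self_left, Nat.mod_eq_of_lt ha, Nat.mod_eq_of_lt hc]
      using congrArg (· % m) h
  subst hac
  have := Nat.eq_of_mul_eq_mul_left (by omega) (Nat.add_left_cancel h)
  ext
  · rfl
  · dsimp only; omega

/-- The cardinality of Λ(m,r) is the genus $(m-1)(r-1)/2$. -/
theorem stmt_1 (m r : ℕ) (hm : 2 ≤ m) (hr : 2 ≤ r) (hgcd : Nat.gcd m r = 1) :
    (Lambda m r).ncard = (m - 1) * (r - 1) / 2 := by
  rw [Lambda_eq_image (by omega) (by omega), (injOn_pointsBelowDiagonal m r).ncard_image,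
    Set.ncard_coe_finset, ← two_mul_card_pointsBelowDiagonal hgcd]
  omega
end

section
/- Let m ≥ 2 and r ≥ 2 be integers with gcd(m, r) = 1. Then the complement ℕ \ Λ(m,r) is closed under addition (and contains 0), i.e. it is an additive submonoid of ℕ. -/
theorem mem_Lambda_iff {m r : ℕ} (hm : 0 < m) (hr : 0 < r) (s : ℕ) :
    s ∈ Lambda m r ↔ s % m ≠ 0 ∧ s / m + r * (s % m) / m + 2 ≤ r := by
  constructor
  · rintro ⟨i, j, hi, hj, rfl⟩
    have hlt : 1 + i < m := by
      generalize m / r = d at hi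
      omega
    rw [Nat.add_mul_mod_self_left, Nat.add_mul_div_left _ _ hm, Nat.mod_eq_of_lt hlt,
      Nat.div_eq_of_lt hlt, add_comm 1 i]
    exact ⟨by omega, by omega⟩
  · rintro ⟨hs, hle⟩
    have hlt : s % m < m := Nat.mod_lt _ hm
    have hdiv : s % m + m * (s / m) = s := Nat.mod_add_div s m
    have hsub : s % m - 1 + 1 = s % m := by omega
    refine ⟨s % m - 1, s / m, ?_, ?_, by omega⟩
    · by_contra! h
      have hm_le : m ≤ s % m + m / r := by omega
      have hfloor : r * (m / r) ≤ m := Nat.mul_div_le m r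
      have hr_le : r - 1 ≤ r * (s % m) / m := by
        rw [Nat.le_div_iff_mul_le hm, Nat.sub_mul, one_mul, Nat.sub_le_iff_le_add]
        calc r * m ≤ r * (s % m + m / r) := Nat.mul_le_mul_left r hm_le
          _ = r * (s % m) + r * (m / r) := mul_add _ _ _
          _ ≤ r * (s % m) + m := Nat.add_le_add_left hfloor _
      have hq := Nat.zero_le (s / m)
      omega
    · rw [hsub]
      omega

/-- The complement ℕ \ Λ(m,r) contains 0 and is closed under addition,
i.e. it is an additive submonoid of ℕ. -/
theorem stmt_2 (m r : ℕ) (hm : 2 ≤ m) (hr : 2 ≤ r) (hgcd : Nat.gcd m r = 1) :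
    0 ∉ Lambda m r ∧
      ∀ a b : ℕ, a ∉ Lambda m r → b ∉ Lambda m r → a + b ∉ Lambda m r := by
  have hm0 : 0 < m := by omega
  have hr0 : 0 < r := by omega
  simp only [mem_Lambda_iff hm0 hr0]
  refine ⟨by simp, fun a b ha hb => ?_⟩
  have hsuper : r * (a % m) / m + r * (b % m) / m ≤ r * (a % m + b % m) / m := by
    rw [mul_add]
    exact Nat.div_add_div_le_add_div
  have ha_lt : a % m < m := Nat.mod_lt _ hm0
  have hb_lt : b % m < m := Nat.mod_lt _ hm0
  rw [Nat.add_div hm0, Nat.add_mod]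
  split_ifs with hcarry
  · have hmod : (a % m + b % m) % m = a % m + b % m - m := by
      rw [Nat.mod_eq_sub_mod hcarry, Nat.mod_eq_of_lt (by omega)]
    have hfloor : r * (a % m + b % m) / m = r * (a % m + b % m - m) / m + r := by
      rw [← Nat.add_mul_div_right _ _ hm0, ← mul_add, Nat.sub_add_cancel hcarry]
    rw [hmod]
    omega
  · rw [Nat.mod_eq_of_lt (not_le.mp hcarry)]
    have hqa := Nat.zero_le (a / m)
    have hqb := Nat.zero_le (b / m)
    have hfa := Nat.zero_le (r * (a % m) / m)
    have hfb := Nat.zero_le (r * (b % m) / m)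
    omega
end

section
/- Let n ≥ 2 and t ≥ 2 be integers, and let H be the additive submonoid of ℕ generated by the t consecutive integers n, n+1, …, n+t−1. Then the cardinality of ℕ \ H equals J·(2(n−1) − (J−1)(t−1))/2, where J = ⌈(n−1)/(t−1)⌉. -/
theorem mem_closure_consecutive_iff (n d x : ℕ) :
    x ∈ AddSubmonoid.closure {k : ℕ | n ≤ k ∧ k ≤ n + d} ↔
      ∃ k, k * n ≤ x ∧ x ≤ k * (n + d) := by
  constructor
  · intro h
    induction h using AddSubmonoid.closure_induction with
    | mem x hx => exact ⟨1, by simpa using hx⟩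
    | zero => exact ⟨0, by simp⟩
    | add x y _ _ ihx ihy =>
      obtain ⟨a, ha, ha'⟩ := ihx
      obtain ⟨b, hb, hb'⟩ := ihy
      exact ⟨a + b, by rw [add_mul]; omega, by rw [add_mul]; omega⟩
  · rintro ⟨k, hk, hk'⟩
    induction k generalizing x with
    | zero =>
      obtain rfl : x = 0 := by omega
      exact zero_mem _
    | succ k ih =>
      rw [add_mul, one_mul] at hk hk'
      have hle : k * n ≤ k * (n + d) := Nat.mul_le_mul_left k (Nat.le_add_right n d)
      by_cases hc : x ≤ k * (n + d) + n
      · have hx : x = (x - n) + n := by omega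
        rw [hx]
        exact add_mem (ih (x - n) (by omega) (by omega))
          (AddSubmonoid.subset_closure ⟨le_rfl, by omega⟩)
      · have hx : x = k * (n + d) + (x - k * (n + d)) := by omega
        rw [hx]
        exact add_mem (ih _ hle le_rfl)
          (AddSubmonoid.subset_closure ⟨by omega, by omega⟩)

theorem notMem_closure_consecutive_iff {n : ℕ} (hn : 0 < n) (d x : ℕ) :
    x ∉ AddSubmonoid.closure {k : ℕ | n ≤ k ∧ k ≤ n + d} ↔
      ∃ k, k * (n + d) < x ∧ x < (k + 1) * n := by
  rw [mem_closure_consecutive_iff]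
  constructor
  · intro h
    push Not at h
    exact ⟨x / n, h _ (Nat.div_mul_le_self x n), Nat.lt_mul_of_div_lt (Nat.lt_succ_self _) hn⟩
  · rintro ⟨k, hk, hk'⟩ ⟨l, hl, hl'⟩
    have h1 : k < l := lt_of_mul_lt_mul_right (hk.trans_le hl') (Nat.zero_le _)
    have h2 : l < k + 1 := lt_of_mul_lt_mul_right (hl.trans_lt hk') (Nat.zero_le _)
    omega

theorem two_mul_sum_range_sub_mul (m d j : ℕ) (h : (j - 1) * d ≤ m) :
    2 * ∑ k ∈ Finset.range j, (m - k * d) = j * (2 * m - (j - 1) * d) := by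
  induction j with
  | zero => simp
  | succ j ih =>
    rw [Nat.add_sub_cancel] at h ⊢
    have h' : (j - 1) * d ≤ m := (Nat.mul_le_mul_right d (Nat.sub_le j 1)).trans h
    rw [Finset.sum_range_succ, mul_add, ih h']
    rcases j with _ | j
    · simp
    · rw [Nat.add_sub_cancel] at h' ⊢
      zify [h, h', show j * d ≤ 2 * m by omega, show (j + 1) * d ≤ 2 * m by omega]
      ring

/-- The genus of the numerical semigroup generated by the `t` consecutive integers
`n, n+1, …, n+t-1` is `J(2(n-1)-(J-1)(t-1))/2` where `J = ⌈(n-1)/(t-1)⌉`. -/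
theorem stmt_3 (n t : ℕ) (hn : 2 ≤ n) (ht : 2 ≤ t)
    (H : AddSubmonoid ℕ)
    (hH : H = AddSubmonoid.closure {k : ℕ | n ≤ k ∧ k ≤ n + t - 1})
    (J : ℕ) (hJ : J = (n - 1 + (t - 1) - 1) / (t - 1)) :
    {x : ℕ | x ∉ H}.ncard = J * (2 * (n - 1) - (J - 1) * (t - 1)) / 2 := by
  obtain ⟨d, rfl⟩ : ∃ d, t = d + 1 := ⟨t - 1, by omega⟩
  obtain ⟨m, rfl⟩ : ∃ m, n = m + 1 := ⟨n - 1, by omega⟩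
  simp only [Nat.add_sub_cancel, ← add_assoc] at hH hJ ⊢
  have hd : 0 < d := by omega
  have lt_J (k : ℕ) : k < J ↔ k * d < m := by
    rw [hJ, ← Nat.succ_le_iff, Nat.le_div_iff_mul_le hd, Nat.succ_mul]
    omega
  have hset : {x : ℕ | x ∉ H} = ((Finset.range J).biUnion
      fun k => Finset.Ioo (k * (m + 1 + d)) ((k + 1) * (m + 1)) : Finset ℕ) := by
    ext x
    simp only [hH, Set.mem_ofPred_eq, notMem_closure_consecutive_iff m.succ_pos, Finset.coe_biUnion,
      Finset.coe_range, Set.mem_Iio, Finset.coe_Ioo, Set.mem_iUnion, Set.mem_Ioo, exists_prop]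
    refine exists_congr fun k => ⟨fun h => ⟨(lt_J k).2 ?_, h⟩, fun h => h.2⟩
    have h1 := h.1
    have h2 := h.2
    rw [mul_add] at h1
    rw [add_mul] at h2
    omega
  have hJm : (J - 1) * d ≤ m := by
    rcases Nat.eq_zero_or_pos J with h | h
    · simp [h]
    · exact ((lt_J (J - 1)).1 (by omega)).le
  rw [hset, Set.ncard_coe_finset, Finset.card_biUnion, ← two_mul_sum_range_sub_mul m d J hJm,
    Nat.mul_div_cancel_left _ two_pos]
  · refine Finset.sum_congr rfl fun k _ => ?_
    rw [Nat.card_Ioo, mul_add k, add_mul k]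
    omega
  · intro k _ l _ hkl
    refine Finset.disjoint_left.2 fun x hx hx' => hkl ?_
    rw [Finset.mem_Ioo] at hx hx'
    have aux {a b : ℕ} (h : a * (m + 1 + d) < x) (h' : x < (b + 1) * (m + 1)) : a < b + 1 :=
      lt_of_mul_lt_mul_right ((Nat.mul_le_mul_left a (Nat.le_add_right _ d)).trans_lt (h.trans h'))
        (Nat.zero_le _)
    have h1 := aux hx.1 hx'.2
    have h2 := aux hx'.1 hx.2
    omega
end

section
/- Let r ≥ 2 and t ≥ 1 be integers and set m = r·t + 1 (so that ⌊m/r⌋ = t). Then the additive submonoid of ℕ generated by the consecutive integers m − t, m − t + 1, …, m equals ℕ \ Λ(m,r). -/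
/-- The monoid generated by the integers in `[a, b]` is the union of the intervals `[n a, n b]`. -/
theorem mem_closure_interval_iff {a b x : ℕ} (hab : a ≤ b) :
    x ∈ AddSubmonoid.closure {k : ℕ | a ≤ k ∧ k ≤ b} ↔ ∃ n : ℕ, n * a ≤ x ∧ x ≤ n * b := by
  constructor
  · intro hx
    induction hx using AddSubmonoid.closure_induction with
    | mem x hx => exact ⟨1, by simpa using hx⟩
    | zero => exact ⟨0, by simp⟩
    | add x y _ _ hx hy =>
      obtain ⟨n, hn, hn'⟩ := hx
      obtain ⟨k, hk, hk'⟩ := hy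
      exact ⟨n + k, by rw [add_mul]; omega, by rw [add_mul]; omega⟩
  · rintro ⟨n, hn, hn'⟩
    induction n generalizing x with
    | zero =>
      obtain rfl : x = 0 := by omega
      exact zero_mem _
    | succ n ih =>
      rw [add_one_mul] at hn hn'
      have hle : n * a ≤ n * b := Nat.mul_le_mul_left n hab
      have hsplit : x = min (x - a) (n * b) + max a (x - n * b) := by omega
      rw [hsplit]
      exact add_mem (ih (by omega) (by omega))
        (AddSubmonoid.subset_closure ⟨by omega, by omega⟩)

theorem mul_succ_div_mul_add_one {r t i : ℕ} (hi : i < r * t) :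
    r * (i + 1) / (r * t + 1) = i / t := by
  have ht : 0 < t := Nat.pos_of_ne_zero (by rintro rfl; simp at hi)
  have hq : i / t < r := (Nat.div_lt_iff_lt_mul ht).2 hi
  have hdiv := Nat.div_add_mod i t
  have hmod := Nat.mod_lt i ht
  generalize i / t = q at *
  generalize i % t = s at *
  subst hdiv
  apply Nat.div_eq_of_lt_le
  · nlinarith [Nat.zero_le (r * s)]
  · nlinarith [Nat.mul_le_mul_left r (Nat.succ_le_of_lt hmod)]

/-- Membership in `Lambda` in terms of the quotient and the remainder modulo `m = r t + 1`. -/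
theorem mem_Lambda_iff_s4 {r t x : ℕ} (hr : 2 ≤ r) (ht : 1 ≤ t) :
    x ∈ Lambda (r * t + 1) r ↔
      ∃ i j : ℕ, i + 1 + t * (j + 1) ≤ r * t ∧ x = 1 + i + (r * t + 1) * j := by
  have hdiv : (r * t + 1) / r = t := by
    rw [Nat.mul_add_div (by omega), Nat.div_eq_of_lt (by omega), add_zero]
  have key (i j : ℕ) (hi : i < r * t) :
      j + r * (i + 1) / (r * t + 1) + 2 ≤ r ↔ i + 1 + t * (j + 1) ≤ r * t := by
    rw [mul_succ_div_mul_add_one hi]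
    have hlt : i / t < r - (j + 1) ↔ i < r * t - (j + 1) * t := by
      rw [Nat.div_lt_iff_lt_mul ht, Nat.sub_mul]
    rw [mul_comm t]
    generalize i / t = q at *
    omega
  simp only [Lambda, Set.mem_ofPred_eq, hdiv]
  constructor
  · rintro ⟨i, j, hi, hj, hx⟩
    exact ⟨i, j, (key i j (by omega)).1 hj, hx⟩
  · rintro ⟨i, j, hij, hx⟩
    have hle : t ≤ t * (j + 1) := Nat.le_mul_of_pos_right t (by omega)
    exact ⟨i, j, by omega, (key i j (by omega)).2 hij, hx⟩

/-- Theorem 3.4: for $m = rt + 1$ the semigroup generated by the consecutive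
integers $m - t, …, m$ equals $ℕ \setminus Λ(m,r)$ (note $⌊m/r⌋ = t$). -/
theorem stmt_4 (r t m : ℕ) (hr : 2 ≤ r) (ht : 1 ≤ t) (hm : m = r * t + 1) :
    (AddSubmonoid.closure {k : ℕ | m - t ≤ k ∧ k ≤ m} : Set ℕ)
      = {x : ℕ | x ∉ Lambda m r} := by
  subst hm
  ext x
  rw [SetLike.mem_coe, mem_closure_interval_iff (Nat.sub_le _ _), Set.mem_ofPred_eq,
    mem_Lambda_iff_s4 hr ht]
  have htm : t ≤ r * t := Nat.le_mul_of_pos_left t (by omega)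
  obtain ⟨d, hd⟩ := Nat.exists_eq_add_of_le htm
  have hsub : r * t + 1 - t = d + 1 := by omega
  rw [hsub, hd]
  constructor
  · rintro ⟨n, hn, hn'⟩ ⟨i, j, hij, rfl⟩
    have hjn : j + 1 ≤ n := by
      by_contra! h
      have := Nat.mul_le_mul_right (t + d + 1) (Nat.le_of_lt_succ h)
      nlinarith
    have := Nat.mul_le_mul_right (d + 1) hjn
    nlinarith
  · intro h
    have hdiv := Nat.div_add_mod x (t + d + 1)
    have hmod := Nat.mod_lt x (show 0 < t + d + 1 by omega)
    generalize x / (t + d + 1) = j at *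
    generalize x % (t + d + 1) = a at *
    subst hdiv
    rcases a with _ | i
    · exact ⟨j, by nlinarith, by nlinarith⟩
    · refine ⟨j + 1, ?_, by nlinarith⟩
      have hij : ¬ i + 1 + t * (j + 1) ≤ t + d := fun hij => h ⟨i, j, hij, by ring⟩
      nlinarith
end

section
/- Let r ≥ 2 and t ≥ 1 be integers and set m = r·t + 1 and g = (m−1)(r−1)/2. Then the largest element of Λ(m,r) is t + m·(r−2) (attained at i = t−1, j = r−2), and t + m·(r−2) = 2g − 1 if and only if t = 1. -/
/-- For $m = rt + 1$ and $g = (m-1)(r-1)/2$: the largest element of $Λ(m,r)$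
is $t + m(r-2)$ (attained at $i = t-1$, $j = r-2$), and it equals $2g - 1$
iff $t = 1$. -/
theorem stmt_6 (r t m g : ℕ) (hr : 2 ≤ r) (ht : 1 ≤ t) (hm : m = r * t + 1)
    (hg : g = (m - 1) * (r - 1) / 2) :
    IsGreatest (Lambda m r) (t + m * (r - 2)) ∧
      (t + m * (r - 2) = 2 * g - 1 ↔ t = 1) := by
  obtain ⟨k, rfl⟩ := Nat.exists_eq_add_of_le' hr
  have hdiv : m / (k + 2) = t := by
    rw [hm, Nat.mul_add_div (by omega), Nat.div_eq_of_lt (by omega), add_zero]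
  have hk : k + 2 - 2 = k := by omega
  have hkt : 2 * t + 1 ≤ m := by rw [hm]; nlinarith
  rw [hk]
  refine ⟨⟨⟨t - 1, k, ?_, ?_, ?_⟩, ?_⟩, ?_⟩
  · omega
  · rw [Nat.sub_add_cancel ht, Nat.div_eq_of_lt (by omega)]
  · omega
  · rintro s ⟨i, j, hi, hj, rfl⟩
    rw [hdiv] at hi
    rcases Nat.eq_zero_or_pos ((k + 2) * (i + 1) / m) with hq | hq
    · have hlt : (k + 2) * (i + 1) < m := (Nat.div_eq_zero_iff_lt (by omega)).1 hq
      have hit : i + 1 ≤ t :=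
        Nat.le_of_mul_le_mul_left (by omega : (k + 2) * (i + 1) ≤ (k + 2) * t) (by omega)
      have hjk : m * j ≤ m * k := Nat.mul_le_mul_left m (by omega)
      omega
    · have hjk : m * (j + 1) ≤ m * k := Nat.mul_le_mul_left m (by omega)
      rw [mul_add_one] at hjk
      omega
  · have h2g : 2 * g = (k + 2) * t * (k + 1) := by
      have hm1 : (m - 1) * (k + 2 - 1) = (k + 2) * t * (k + 1) := by
        rw [hm, Nat.add_sub_cancel]; rfl
      rw [hg, hm1]
      apply Nat.mul_div_cancel'
      have h : 2 ∣ (k + 1) * (k + 2) := (Nat.even_mul_succ_self (k + 1)).two_dvd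
      exact (h.mul_right t).trans (dvd_of_eq (by ring))
    have hkey : 2 * g + (k + 1) = t + m * k + 1 + (k + 1) * t := by
      rw [h2g, hm]; ring
    have hpos : 1 ≤ 2 * g := by rw [h2g]; exact Nat.mul_pos (by positivity) (by omega)
    constructor
    · intro h
      have : (k + 1) * t = (k + 1) * 1 := by omega
      exact Nat.eq_of_mul_eq_mul_left (by omega) this
    · rintro rfl
      omega
end

section
/- Let m ≥ 2 and r ≥ 2 be integers with gcd(m, r) = 1. Then every integer s with m − ⌊m/r⌋ ≤ s ≤ m satisfies s ∉ Λ(m,r); that is, the consecutive integers m − ⌊m/r⌋, m − ⌊m/r⌋ + 1, …, m all lie in ℕ \ Λ(m,r). -/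
/-- The consecutive integers $m - ⌊m/r⌋, …, m$ are all non-gaps,
i.e. they lie in $ℕ \setminus Λ(m,r)$. -/
theorem stmt_7 (m r : ℕ) (hm : 2 ≤ m) (hr : 2 ≤ r) (hgcd : Nat.gcd m r = 1) :
    ∀ s : ℕ, m - m / r ≤ s → s ≤ m → s ∉ Lambda m r := by
  rintro s hs hsm ⟨i, j, hi, -, rfl⟩
  rcases Nat.eq_zero_or_pos j with rfl | hj
  · omega
  · have := Nat.le_mul_of_pos_right m hj
    omega
end

section
/- Let m ≥ 2 and r ≥ 2 be integers with gcd(m, r) = 1. Then the set Γ' = {(m·r − m·j − r·i, i + m·(j−1)) : i, j ∈ ℤ, 1 ≤ i ≤ m − 1 − ⌊m/r⌋, 1 ≤ j ≤ r − 1 − ⌊r·i/m⌋} ⊆ ℕ × ℕ has cardinality (m−1)(r−1)/2. -/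
/-- The positive lattice points strictly below the diagonal of an `m × r` rectangle. -/
def latticeTriangle (m r : ℕ) : Finset (ℕ × ℕ) :=
  {q ∈ Finset.Ico 1 m ×ˢ Finset.Ico 1 r | r * q.1 + m * q.2 < m * r}

lemma mul_add_mul_ne_mul {m r : ℕ} (h : m.Coprime r) {i j : ℕ} (hi : 1 ≤ i) (him : i < m) :
    r * i + m * j ≠ m * r := by
  intro e
  have hd : m ∣ r * i := (Nat.dvd_add_left (dvd_mul_right m j)).1 (e ▸ dvd_mul_right m r)
  exact absurd (Nat.le_of_dvd hi (h.dvd_of_dvd_mul_left hd)) (by lia)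

lemma two_mul_card_latticeTriangle {m r : ℕ} (h : m.Coprime r) :
    2 * (latticeTriangle m r).card = (m - 1) * (r - 1) := by
  have hsplit := Finset.card_filter_add_card_filter_not (s := Finset.Ico 1 m ×ˢ Finset.Ico 1 r)
    (fun q : ℕ × ℕ => r * q.1 + m * q.2 < m * r)
  have hreflect : (latticeTriangle m r).card =
      ({q ∈ Finset.Ico 1 m ×ˢ Finset.Ico 1 r | ¬ r * q.1 + m * q.2 < m * r}).card := by
    refine Finset.card_nbij' (fun q => (m - q.1, r - q.2)) (fun q => (m - q.1, r - q.2))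
      ?_ ?_ ?_ ?_
    · rintro ⟨i, j⟩ hq
      simp only [latticeTriangle, Finset.coe_filter, Finset.mem_product, Finset.mem_Ico,
        Set.mem_ofPred_eq] at hq ⊢
      obtain ⟨⟨⟨hi, him⟩, hj, hjr⟩, hlt⟩ := hq
      obtain ⟨a, rfl⟩ := Nat.exists_eq_add_of_lt him
      obtain ⟨b, rfl⟩ := Nat.exists_eq_add_of_lt hjr
      refine ⟨by lia, ?_⟩
      rw [show i + a + 1 - i = a + 1 by lia, show j + b + 1 - j = b + 1 by lia]
      nlinarith
    · rintro ⟨i, j⟩ hq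
      simp only [latticeTriangle, Finset.coe_filter, Finset.mem_product, Finset.mem_Ico,
        Set.mem_ofPred_eq] at hq ⊢
      obtain ⟨⟨⟨hi, him⟩, hj, hjr⟩, hle⟩ := hq
      have hlt := lt_of_le_of_ne (not_lt.1 hle) (mul_add_mul_ne_mul h (j := j) hi him).symm
      obtain ⟨a, rfl⟩ := Nat.exists_eq_add_of_lt him
      obtain ⟨b, rfl⟩ := Nat.exists_eq_add_of_lt hjr
      refine ⟨by lia, ?_⟩
      rw [show i + a + 1 - i = a + 1 by lia, show j + b + 1 - j = b + 1 by lia]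
      nlinarith
    all_goals
      rintro ⟨i, j⟩ hq
      simp only [latticeTriangle, Finset.coe_filter, Finset.mem_product, Finset.mem_Ico,
        Set.mem_ofPred_eq] at hq
      ext <;> dsimp only <;> lia
  rw [← hreflect, Finset.card_product, Nat.card_Ico, Nat.card_Ico] at hsplit
  rw [← hsplit, two_mul, latticeTriangle]

lemma le_sub_one_sub_div_iff {m r a j : ℕ} (hm : 0 < m) (hj : 1 ≤ j) :
    j ≤ r - 1 - a / m ↔ a + m * j < m * r := by
  rw [mul_comm m r, ← Nat.div_lt_iff_lt_mul hm, Nat.add_mul_div_left _ _ hm]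
  lia

lemma mem_latticeTriangle_iff {m r i j : ℕ} (hm : 0 < m) (hr : 0 < r) :
    (i, j) ∈ latticeTriangle m r ↔
      1 ≤ i ∧ i ≤ m - 1 - m / r ∧ 1 ≤ j ∧ j ≤ r - 1 - r * i / m := by
  simp only [latticeTriangle, Finset.mem_filter, Finset.mem_product, Finset.mem_Ico]
  constructor
  · rintro ⟨⟨⟨hi, -⟩, hj, -⟩, hlt⟩
    refine ⟨hi, (le_sub_one_sub_div_iff hr hi).2 ?_, hj, (le_sub_one_sub_div_iff hm hj).2 hlt⟩
    nlinarith
  · rintro ⟨hi, him, hj, hjr⟩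
    exact ⟨⟨⟨hi, by lia⟩, hj, by lia⟩, (le_sub_one_sub_div_iff hm hj).1 hjr⟩

lemma injOn_add_mul_sub_one (m r : ℕ) :
    Set.InjOn (fun q : ℕ × ℕ => (m * r - m * q.2 - r * q.1, q.1 + m * (q.2 - 1)))
      (latticeTriangle m r) := by
  rintro ⟨i, j⟩ h ⟨k, l⟩ h' e
  simp only [latticeTriangle, Finset.coe_filter, Finset.mem_product, Finset.mem_Ico,
    Set.mem_ofPred_eq] at h h'
  have e₂ : i + m * (j - 1) = k + m * (l - 1) := congrArg Prod.snd e
  have hik : i = k := by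
    simpa [Nat.add_mul_mod_self_left, Nat.mod_eq_of_lt h.1.1.2, Nat.mod_eq_of_lt h'.1.1.2]
      using congrArg (· % m) e₂
  subst hik
  have hjl : j - 1 = l - 1 := Nat.eq_of_mul_eq_mul_left (by lia) (Nat.add_left_cancel e₂)
  ext <;> dsimp only
  lia

/-- The set `Γ' = {(mr - mj - ri, i + m(j-1))}` indexed by
`1 ≤ i ≤ m - 1 - ⌊m/r⌋`, `1 ≤ j ≤ r - 1 - ⌊ri/m⌋` has cardinality
`(m-1)(r-1)/2`, the genus of the curve. -/
theorem stmt_11 (m r : ℕ) (hm : 2 ≤ m) (hr : 2 ≤ r) (hgcd : Nat.gcd m r = 1) :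
    {p : ℕ × ℕ | ∃ i j : ℕ, 1 ≤ i ∧ i ≤ m - 1 - m / r ∧
        1 ≤ j ∧ j ≤ r - 1 - (r * i) / m ∧
        p = (m * r - m * j - r * i, i + m * (j - 1))}.ncard
      = (m - 1) * (r - 1) / 2 := by
  have himage : {p : ℕ × ℕ | ∃ i j : ℕ, 1 ≤ i ∧ i ≤ m - 1 - m / r ∧
        1 ≤ j ∧ j ≤ r - 1 - (r * i) / m ∧
        p = (m * r - m * j - r * i, i + m * (j - 1))} =
      (fun q : ℕ × ℕ => (m * r - m * q.2 - r * q.1, q.1 + m * (q.2 - 1))) ''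
        (latticeTriangle m r) := by
    ext p
    simp only [Set.mem_ofPred_eq, Set.mem_image, Prod.exists, Finset.mem_coe,
      mem_latticeTriangle_iff (show 0 < m by lia) (show 0 < r by lia), and_assoc, eq_comm]
  rw [himage, (injOn_add_mul_sub_one m r).ncard_image, Set.ncard_coe_finset,
    ← two_mul_card_latticeTriangle hgcd]
  lia
end

section
/- Let m ≥ 2 and r ≥ 2 be integers with gcd(m, r) = 1. Then {m·r − m·j − r·i : i, j ∈ ℤ, 1 ≤ i ≤ m − 1 − ⌊m/r⌋, 1 ≤ j ≤ r − 1 − ⌊r·i/m⌋} = ℕ \ ⟨m, r⟩, i.e. the first coordinates of Γ' run exactly over all gaps of the numerical semigroup generated by m and r, and moreover the map (i, j) ↦ m·r − m·j − r·i is injective on this index set. -/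
/-- The floor inequalities describing the index set say exactly that `(i, j)` is a lattice point
in the interior of the triangle cut out by `m * j + r * i < m * r`. -/
lemma floor_bounds_iff {m r : ℕ} (hm : 0 < m) (hr : 0 < r) (i j : ℕ) :
    (1 ≤ i ∧ i ≤ m - 1 - m / r ∧ 1 ≤ j ∧ j ≤ r - 1 - (r * i) / m) ↔
      1 ≤ i ∧ 1 ≤ j ∧ m * j + r * i < m * r := by
  constructor
  · rintro ⟨hi, -, hj, h⟩
    refine ⟨hi, hj, ?_⟩
    have h' : (r * i) / m < r - j := by
      generalize (r * i) / m = q at h ⊢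
      omega
    rw [Nat.div_lt_iff_lt_mul hm] at h'
    obtain ⟨k, rfl⟩ : ∃ k, r = k + j :=
      ⟨r - j, (Nat.sub_add_cancel (h.trans ((Nat.sub_le _ _).trans (Nat.sub_le _ _)))).symm⟩
    rw [Nat.add_sub_cancel] at h'
    nlinarith
  · rintro ⟨hi, hj, h⟩
    have hjr : j < r := by
      by_contra! hc
      nlinarith [Nat.mul_le_mul_left m hc]
    have him : i < m := by
      by_contra! hc
      nlinarith [Nat.mul_le_mul_left r hc]
    have h₁ : (r * i) / m < r - j := by
      rw [Nat.div_lt_iff_lt_mul hm, Nat.sub_mul]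
      have := Nat.mul_comm r m
      have := Nat.mul_comm j m
      omega
    have h₂ : m / r < m - i := by
      rw [Nat.div_lt_iff_lt_mul hr, Nat.sub_mul]
      have := Nat.mul_comm i r
      have := Nat.le_mul_of_pos_right m hj
      omega
    generalize (r * i) / m = q at h₁ ⊢
    generalize m / r = p at h₂ ⊢
    omega

/-- A gap of `⟨m, r⟩` differs from `m * r` by a positive combination of `m` and `r`. -/
lemma exists_pos_add_eq_of_notMem_closure {m r n : ℕ} (hm : 0 < m) (hgcd : Nat.Coprime m r)
    (hn : n ∉ AddSubmonoid.closure ({m, r} : Set ℕ)) :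
    ∃ i j : ℕ, 1 ≤ i ∧ 1 ≤ j ∧ n + m * j + r * i = m * r := by
  simp only [AddSubmonoid.mem_closure_pair, smul_eq_mul, not_exists] at hn
  obtain ⟨i, him, hdvd⟩ : ∃ i < m, m ∣ n + r * i := by
    have : NeZero m := ⟨hm.ne'⟩
    refine ⟨(-(n : ZMod m) * (r : ZMod m)⁻¹).val, ZMod.val_lt _, ?_⟩
    rw [← ZMod.natCast_eq_zero_iff]
    push_cast
    rw [ZMod.natCast_zmod_val]
    linear_combination (-(n : ZMod m)) * ZMod.coe_mul_inv_eq_one r hgcd.symm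
  obtain ⟨k, hk⟩ := hdvd
  have hi : 1 ≤ i := by
    by_contra! hc
    obtain rfl : i = 0 := by omega
    exact hn k 0 (by linarith)
  have hkr : k < r := by
    by_contra! hc
    obtain ⟨c, rfl⟩ := Nat.exists_eq_add_of_le hc
    obtain ⟨d, rfl⟩ := Nat.exists_eq_add_of_lt him
    exact hn c (d + 1) (by nlinarith)
  obtain ⟨d, rfl⟩ := Nat.exists_eq_add_of_lt hkr
  exact ⟨i, d + 1, hi, by omega, by nlinarith⟩

/-- Subtracting a positive combination of `m` and `r` from `m * r` never lands in `⟨m, r⟩`. -/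
lemma notMem_closure_of_add_eq {m r n i j : ℕ} (hm : 0 < m) (hgcd : Nat.Coprime m r)
    (hi : 1 ≤ i) (hj : 1 ≤ j) (h : n + m * j + r * i = m * r) :
    n ∉ AddSubmonoid.closure ({m, r} : Set ℕ) := by
  simp only [AddSubmonoid.mem_closure_pair, smul_eq_mul, not_exists]
  rintro a b rfl
  have hsum : m * (a + j) + r * (b + i) = m * r := by linarith
  have hdvd : m ∣ r * (b + i) :=
    (Nat.dvd_add_right (dvd_mul_right m (a + j))).mp (hsum ▸ dvd_mul_right m r)
  have hle : m ≤ b + i := Nat.le_of_dvd (by omega) (hgcd.dvd_of_dvd_mul_left hdvd)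
  nlinarith [Nat.mul_le_mul_left r hle, Nat.mul_pos hm (show 0 < a + j by omega)]

/-- Two representations by coprime `m` and `r` whose coefficients of `r` are less than `m`
agree. -/
lemma eq_and_eq_of_mul_add_mul_eq {m r i₁ j₁ i₂ j₂ : ℕ} (hm : 0 < m) (hgcd : Nat.Coprime m r)
    (h₁ : i₁ < m) (h₂ : i₂ < m) (h : m * j₁ + r * i₁ = m * j₂ + r * i₂) :
    i₁ = i₂ ∧ j₁ = j₂ := by
  have hmod : r * i₁ ≡ r * i₂ [MOD m] := by
    have := congrArg (· % m) h
    simpa [Nat.ModEq, Nat.mul_add_mod] using this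
  obtain rfl : i₁ = i₂ :=
    (Nat.ModEq.cancel_left_of_coprime hgcd hmod).eq_of_lt_of_lt h₁ h₂
  exact ⟨rfl, Nat.eq_of_mul_eq_mul_left hm (Nat.add_right_cancel h)⟩

/-- The first coordinates of `Γ'` run exactly over all gaps of the numerical
semigroup `⟨m, r⟩`, and the map `(i, j) ↦ mr - mj - ri` is injective on the
index set. -/
theorem stmt_12 (m r : ℕ) (hm : 2 ≤ m) (hr : 2 ≤ r) (hgcd : Nat.gcd m r = 1) :
    ({n : ℕ | ∃ i j : ℕ, 1 ≤ i ∧ i ≤ m - 1 - m / r ∧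
        1 ≤ j ∧ j ≤ r - 1 - (r * i) / m ∧ n = m * r - m * j - r * i}
      = {n : ℕ | n ∉ AddSubmonoid.closure ({m, r} : Set ℕ)}) ∧
    ∀ i₁ j₁ i₂ j₂ : ℕ,
      (1 ≤ i₁ ∧ i₁ ≤ m - 1 - m / r ∧ 1 ≤ j₁ ∧ j₁ ≤ r - 1 - (r * i₁) / m) →
      (1 ≤ i₂ ∧ i₂ ≤ m - 1 - m / r ∧ 1 ≤ j₂ ∧ j₂ ≤ r - 1 - (r * i₂) / m) →
      m * r - m * j₁ - r * i₁ = m * r - m * j₂ - r * i₂ →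
      i₁ = i₂ ∧ j₁ = j₂ := by
  have hm₀ : 0 < m := by omega
  have hr₀ : 0 < r := by omega
  refine ⟨?_, ?_⟩
  · ext n
    constructor
    · rintro ⟨i, j, hi, hi', hj, hj', rfl⟩
      obtain ⟨-, -, h⟩ := (floor_bounds_iff hm₀ hr₀ i j).mp ⟨hi, hi', hj, hj'⟩
      exact notMem_closure_of_add_eq hm₀ hgcd hi hj (by omega)
    · intro hn
      obtain ⟨i, j, hi, hj, h⟩ := exists_pos_add_eq_of_notMem_closure hm₀ hgcd hn
      have hn₀ : n ≠ 0 := by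
        rintro rfl
        exact hn (zero_mem _)
      obtain ⟨-, hi', -, hj'⟩ := (floor_bounds_iff hm₀ hr₀ i j).mpr ⟨hi, hj, by omega⟩
      exact ⟨i, j, hi, hi', hj, hj', by omega⟩
  · intro i₁ j₁ i₂ j₂ h₁ h₂ h
    have hlt₁ := ((floor_bounds_iff hm₀ hr₀ i₁ j₁).mp h₁).2.2
    have hlt₂ := ((floor_bounds_iff hm₀ hr₀ i₂ j₂).mp h₂).2.2
    exact eq_and_eq_of_mul_add_mul_eq hm₀ hgcd (by nlinarith) (by nlinarith) (by omega)
end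

section
/- Let q > 3 and ℓ ≥ 1 be integers, and set a = q^{ℓ+1} − 2q^ℓ − 2 and m = q^ℓ + 1. Then for every integer i with 0 ≤ i ≤ q − 1 and every integer t with i·q^{ℓ−1} ≤ t ≤ (i+1)·q^{ℓ−1} − 1, one has ⌊(a − q·t)/m⌋ = q − 3 − i; and for t = q^ℓ one has ⌊(a − q·t)/m⌋ = −2. -/
/-- Floor computation (A) in the proof of Proposition 4.3: with
`a = q^{ℓ+1} - 2q^ℓ - 2` and `m = q^ℓ + 1`, for `0 ≤ i ≤ q - 1` and
`iq^{ℓ-1} ≤ t ≤ (i+1)q^{ℓ-1} - 1` we have `⌊(a - qt)/m⌋ = q - 3 - i`,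
and for `t = q^ℓ` we have `⌊(a - qt)/m⌋ = -2`.  (`Int.fdiv` is floor
division, rounding toward `-∞`.) -/
theorem stmt_14 (q l : ℕ) (hq : 3 < q) (hl : 1 ≤ l) (a m : ℤ)
    (ha : a = (q : ℤ) ^ (l + 1) - 2 * (q : ℤ) ^ l - 2)
    (hm : m = (q : ℤ) ^ l + 1) :
    (∀ i t : ℤ, 0 ≤ i → i ≤ (q : ℤ) - 1 →
        i * (q : ℤ) ^ (l - 1) ≤ t → t ≤ (i + 1) * (q : ℤ) ^ (l - 1) - 1 →
        Int.fdiv (a - (q : ℤ) * t) m = (q : ℤ) - 3 - i) ∧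
    Int.fdiv (a - (q : ℤ) * (q : ℤ) ^ l) m = -2 := by
  have hq' : (3 : ℤ) < q := by exact_mod_cast hq
  have hpow : (q : ℤ) ^ l = q * (q : ℤ) ^ (l - 1) := by
    rw [← pow_succ', Nat.sub_add_cancel hl]
  have hm0 : 0 < m := by rw [hm]; positivity
  rw [Int.fdiv_eq_ediv_of_nonneg _ hm0.le]
  constructor
  · intro i t hi hiq hlo hhi
    have hlo' := mul_le_mul_of_nonneg_left hlo (by lia : (0 : ℤ) ≤ q)
    have hhi' := mul_le_mul_of_nonneg_left hhi (by lia : (0 : ℤ) ≤ q)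
    rw [Int.fdiv_eq_ediv_of_nonneg _ hm0.le, Int.ediv_eq_iff_of_pos hm0]
    rw [ha, hm, pow_succ', hpow]
    constructor <;> linarith
  · rw [show a - (q : ℤ) * (q : ℤ) ^ l = -2 * m by rw [ha, hm]; ring]
    exact Int.mul_ediv_cancel _ hm0.ne'
end

section
/- Let q > 3 and ℓ ≥ 1 be integers, and set a = q^{ℓ+1} − 2q^ℓ − 2 and m = q^ℓ + 1. Then for every integer t with 0 ≤ t ≤ q^ℓ, exactly one of the following holds: (1) ⌊(a − q·t)/m⌋ + ⌊(1 + t)/m⌋ < 0; or (2) ⌊(a − q·t)/m⌋ + ⌊(1 + t)/m⌋ ≥ 0 and ⌊(a − q·t)/m⌋ + ⌊(1 + t)/m⌋ = ⌊(a − 1 − q·t)/m⌋ + ⌊t/m⌋. -/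
theorem Int.sub_one_ediv_of_not_dvd {d m : ℤ} (hm : 0 < m) (h : ¬ m ∣ d) :
    (d - 1) / m = d / m := by
  have hr : 0 < d % m :=
    lt_of_le_of_ne (Int.emod_nonneg d hm.ne') fun h0 => h (Int.dvd_of_emod_eq_zero h0.symm)
  have hlt := Int.emod_lt_of_pos d hm
  have hd := Int.emod_add_mul_ediv d m
  rw [Int.ediv_eq_iff_of_pos hm]
  constructor <;> nlinarith

theorem Int.isCoprime_pow_add_one (q : ℤ) {l : ℕ} (hl : 1 ≤ l) : IsCoprime (q ^ l + 1) q := by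
  obtain ⟨k, rfl⟩ := Nat.exists_eq_add_of_le' hl
  exact ⟨1, -q ^ k, by ring⟩

/-- The pure-gap condition of Theorem 4.2 verified in Proposition 4.3: with
`a = q^{ℓ+1} - 2q^ℓ - 2` and `m = q^ℓ + 1`, for every `0 ≤ t ≤ q^ℓ` exactly
one of the following holds:
(1) `⌊(a - qt)/m⌋ + ⌊(1+t)/m⌋ < 0`; or
(2) `⌊(a - qt)/m⌋ + ⌊(1+t)/m⌋ ≥ 0` and
    `⌊(a - qt)/m⌋ + ⌊(1+t)/m⌋ = ⌊(a - 1 - qt)/m⌋ + ⌊t/m⌋`.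
(`Int.fdiv` is floor division, rounding toward `-∞`.) -/
theorem stmt_15 (q l : ℕ) (hq : 3 < q) (hl : 1 ≤ l) (a m : ℤ)
    (ha : a = (q : ℤ) ^ (l + 1) - 2 * (q : ℤ) ^ l - 2)
    (hm : m = (q : ℤ) ^ l + 1) :
    ∀ t : ℤ, 0 ≤ t → t ≤ (q : ℤ) ^ l →
      Xor'
        (Int.fdiv (a - (q : ℤ) * t) m + Int.fdiv (1 + t) m < 0)
        (0 ≤ Int.fdiv (a - (q : ℤ) * t) m + Int.fdiv (1 + t) m ∧
          Int.fdiv (a - (q : ℤ) * t) m + Int.fdiv (1 + t) m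
            = Int.fdiv (a - 1 - (q : ℤ) * t) m + Int.fdiv t m) := by
  intro t ht0 htQ
  have hQ : (0 : ℤ) < (q : ℤ) ^ l := by positivity
  have hm0 : 0 < m := by omega
  simp only [Int.fdiv_eq_ediv_of_nonneg _ hm0.le]
  have hat : a - q * t = (q - 2) * m - q * (1 + t) := by
    rw [ha, hm]
    ring
  rcases htQ.eq_or_lt with rfl | hlt
  · have h1 : (a - q * (q : ℤ) ^ l) / m = -2 := by
      rw [show a - q * (q : ℤ) ^ l = -2 * m by rw [hat, hm]; ring]
      exact Int.mul_ediv_cancel _ hm0.ne'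
    have h2 : (1 + (q : ℤ) ^ l) / m = 1 := by
      rw [add_comm, ← hm]
      exact Int.ediv_self hm0.ne'
    rw [h1, h2]
    exact Or.inl ⟨by norm_num, fun h => by norm_num at h⟩
  · have hnd : ¬ m ∣ a - q * t := by
      intro h
      rw [hat, dvd_sub_right (Dvd.intro_left _ rfl)] at h
      have hcop : IsCoprime m (q : ℤ) := hm ▸ Int.isCoprime_pow_add_one q hl
      have := Int.le_of_dvd (by omega) (hcop.dvd_of_dvd_mul_left h)
      omega
    rw [show a - 1 - q * t = a - q * t - 1 by ring, Int.sub_one_ediv_of_not_dvd hm0 hnd,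
      Int.ediv_eq_zero_of_lt (by omega : 0 ≤ 1 + t) (by omega),
      Int.ediv_eq_zero_of_lt ht0 (by omega)]
    rcases lt_or_ge ((a - q * t) / m + 0) 0 with h | h
    · exact Or.inl ⟨h, fun h' => h'.1.not_gt h⟩
    · exact Or.inr ⟨⟨h, rfl⟩, h.not_gt⟩
end
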